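/- Every everywhere somewhere dense filter on the set 2^{<ω} of finite binary strings extends to an everywhere somewhere dense ultrafilter on 2^{<ω}. -/

import Mathlib

/-- `X` is dense above `σ` in the full binary tree `2^{<ω}`: every `τ ⊵ σ`
has an extension `η ⊵ τ` lying in `X`. -/
def DenseAbove (X : Set (List Bool)) (σ : List Bool) : Prop :=
  ∀ τ : List Bool, σ <+: τ → ∃ η ∈ X, τ <+: η

/-- `X ⊆ 2^{<ω}` is somewhere dense if it is dense above some node `σ`. -/
def SomewhereDense (X : Set (List Bool)) : Prop :=
  ∃ σ : List Bool, DenseAbove X σ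

theorem DenseAbove.mono {X Y : Set (List Bool)} {σ : List Bool} (h : X ⊆ Y)
    (hX : DenseAbove X σ) : DenseAbove Y σ := fun τ hτ =>
  let ⟨η, hη, hle⟩ := hX τ hτ
  ⟨η, h hη, hle⟩

theorem SomewhereDense.mono {X Y : Set (List Bool)} (h : X ⊆ Y) (hX : SomewhereDense X) :
    SomewhereDense Y :=
  hX.imp fun _ => DenseAbove.mono h

theorem not_somewhereDense_empty : ¬ SomewhereDense ∅ := by
  rintro ⟨σ, hσ⟩
  obtain ⟨η, hη, -⟩ := hσ σ List.prefix_rfl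
  exact hη

theorem SomewhereDense.of_union {X Y : Set (List Bool)} (h : SomewhereDense (X ∪ Y)) :
    SomewhereDense X ∨ SomewhereDense Y := by
  obtain ⟨σ, hσ⟩ := h
  by_cases hX : DenseAbove X σ
  · exact Or.inl ⟨σ, hX⟩
  · simp only [DenseAbove, not_forall, not_exists, not_and] at hX
    obtain ⟨τ, hστ, hτ⟩ := hX
    refine Or.inr ⟨τ, fun ρ hτρ => ?_⟩
    obtain ⟨η, hη | hη, hρη⟩ := hσ ρ (hστ.trans hτρ)
    · exact absurd (hτρ.trans hρη) (hτ η hη)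
    · exact ⟨η, hη, hρη⟩

/-- The filter of sets whose complement is nowhere dense. -/
def coNowhereDense : Filter (List Bool) :=
  Filter.comk (fun X => ¬ SomewhereDense X) not_somewhereDense_empty
    (fun _ ht _ hst hs => ht (hs.mono hst))
    (fun _ hs _ ht hst => hst.of_union.elim hs ht)

theorem compl_mem_coNowhereDense {X : Set (List Bool)} :
    Xᶜ ∈ coNowhereDense ↔ ¬ SomewhereDense X :=
  Filter.compl_mem_comk

/-- Every everywhere somewhere dense (proper) filter on `2^{<ω}` extends to an
everywhere somewhere dense ultrafilter on `2^{<ω}`. -/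
theorem exists_everywhereSomewhereDense_ultrafilter (F : Filter (List Bool))
    (hproper : F.NeBot) (hF : ∀ X ∈ F, SomewhereDense X) :
    ∃ U : Ultrafilter (List Bool), (U : Filter (List Bool)) ≤ F ∧
      ∀ X ∈ (U : Filter (List Bool)), SomewhereDense X := by
  have hne : (F ⊓ coNowhereDense).NeBot := by
    refine Filter.inf_neBot_iff.2 fun {A} hA {B} hB => ?_
    by_contra hAB
    rw [← compl_compl B, compl_mem_coNowhereDense] at hB
    exact hB ((hF A hA).mono fun x hxA hxB => hAB ⟨x, hxA, hxB⟩)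
  refine ⟨Ultrafilter.of (F ⊓ coNowhereDense),
    (Ultrafilter.of_le _).trans inf_le_left, fun X hX => ?_⟩
  by_contra hXn
  exact Ultrafilter.compl_mem_iff_notMem.1
    (((Ultrafilter.of_le _).trans inf_le_right) (compl_mem_coNowhereDense.2 hXn)) hX
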